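/- For every natural number n > 2, o3(n + 2) + o3(n - 1) = c(n). -/

import Mathlib

/-- `c n` is the number of partitions of `n` in which no part is
congruent to 2 modulo 4. -/
noncomputable def c (n : ℕ) : ℕ :=
  Nat.card {p : n.Partition // ∀ a ∈ p.parts, a % 4 ≠ 2}

/-- `o3 n` is the number of partitions of `n` in which every odd part
appears at most once, the largest part is even, and the largest part
appears exactly once (the empty partition is counted). -/
noncomputable def o3 (n : ℕ) : ℕ :=
  Nat.card {p : n.Partition //
    (∀ a : ℕ, Odd a → p.parts.count a ≤ 1) ∧ Even p.parts.sup ∧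
      (p.parts = 0 ∨ p.parts.count p.parts.sup = 1)}

open Finset PowerSeries

open scoped PowerSeries.WithPiTopology Classical in
/-- The generating function of the partitions into parts at most `N` in which the multiplicity `m`
of every part `i` satisfies `P i m`. -/
noncomputable def boundedGenFun (P : ℕ → ℕ → Prop) (N : ℕ) : ℤ⟦X⟧ :=
  Nat.Partition.genFun fun i m ↦ if i ≤ N ∧ P i m then 1 else 0

open scoped Classical in
theorem coeff_boundedGenFun (P : ℕ → ℕ → Prop) (N n : ℕ) :
    coeff n (boundedGenFun P N) =
      #{p : n.Partition | ∀ a ∈ p.parts, a ≤ N ∧ P a (p.parts.count a)} := by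
  simp_rw [boundedGenFun, Nat.Partition.coeff_genFun, card_filter, Finsupp.prod, prod_boole]
  simp

open scoped PowerSeries.WithPiTopology Classical in
theorem boundedGenFun_eq_prod (P : ℕ → ℕ → Prop) (N : ℕ) :
    boundedGenFun P N = ∏ i ∈ range N,
      (1 + ∑' j, (if P (i + 1) (j + 1) then (1 : ℤ) else 0) • X ^ ((i + 1) * (j + 1))) := by
  refine (Nat.Partition.hasProd_genFun _).unique ?_
  have hprod : ∏ i ∈ range N,
      (1 + ∑' j, (if P (i + 1) (j + 1) then (1 : ℤ) else 0) • X ^ ((i + 1) * (j + 1))) =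
      ∏ i ∈ range N, (1 + ∑' j, (if i + 1 ≤ N ∧ P (i + 1) (j + 1) then (1 : ℤ) else 0) •
        (X : ℤ⟦X⟧) ^ ((i + 1) * (j + 1))) := by
    refine prod_congr rfl fun i hi ↦ ?_
    have : i + 1 ≤ N := by simpa [Nat.succ_le_iff] using hi
    simp only [this, true_and]
  rw [hprod]
  refine hasProd_prod_of_ne_finset_one fun i hi ↦ ?_
  have hN : ¬ i + 1 ≤ N := by simpa [Nat.succ_le_iff] using hi
  have hz (j : ℕ) : (0 : ℤ) • (X : ℤ⟦X⟧) ^ ((i + 1) * (j + 1)) = 0 := zero_smul ℤ _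
  simp only [hN, false_and, if_false, add_eq_left]
  exact (tsum_congr hz).trans tsum_zero

theorem boundedGenFun_zero (P : ℕ → ℕ → Prop) : boundedGenFun P 0 = 1 := by
  simp [boundedGenFun_eq_prod]

theorem boundedGenFun_succ_of_forbidden {P : ℕ → ℕ → Prop} {N : ℕ}
    (h : ∀ m, ¬ P (N + 1) (m + 1)) : boundedGenFun P (N + 1) = boundedGenFun P N := by
  simp [boundedGenFun_eq_prod, prod_range_succ, h]

open scoped PowerSeries.WithPiTopology in
theorem boundedGenFun_succ_of_distinct {P : ℕ → ℕ → Prop} {N : ℕ}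
    (h : ∀ m, P (N + 1) (m + 1) ↔ m = 0) :
    boundedGenFun P (N + 1) = boundedGenFun P N * (1 + X ^ (N + 1)) := by
  rw [boundedGenFun_eq_prod, prod_range_succ, ← boundedGenFun_eq_prod, tsum_eq_single 0]
  · simp [h]
  · intro m hm
    simp [h, hm]

open scoped PowerSeries.WithPiTopology in
theorem boundedGenFun_succ_of_free {P : ℕ → ℕ → Prop} {N : ℕ}
    (h : ∀ m, P (N + 1) (m + 1)) :
    boundedGenFun P (N + 1) * (1 - X ^ (N + 1)) = boundedGenFun P N := by
  have hX : constantCoeff ((X : ℤ⟦X⟧) ^ (N + 1)) = 0 := by simp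
  have hs := WithPiTopology.summable_pow_of_constantCoeff_eq_zero hX
  have key : (1 + ∑' j, (X : ℤ⟦X⟧) ^ ((N + 1) * (j + 1))) * (1 - X ^ (N + 1)) = 1 := by
    refine Eq.trans ?_ (WithPiTopology.tsum_pow_mul_one_sub_of_constantCoeff_eq_zero hX)
    rw [hs.tsum_eq_zero_add]
    simp [pow_mul]
  rw [boundedGenFun_eq_prod, prod_range_succ, ← boundedGenFun_eq_prod, mul_assoc]
  simp [h, key]

/-- The condition that odd parts appear at most once. -/
def OddDistinct (i m : ℕ) : Prop := Odd i → m ≤ 1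

/-- The condition that no part is congruent to 2 modulo 4. -/
def NotTwoModFour (i _m : ℕ) : Prop := i % 4 ≠ 2

theorem boundedGenFun_oddDistinct_odd (k : ℕ) :
    boundedGenFun OddDistinct (2 * k + 1) =
      boundedGenFun OddDistinct (2 * k) * (1 + X ^ (2 * k + 1)) :=
  boundedGenFun_succ_of_distinct fun m ↦ by simp [OddDistinct]

theorem boundedGenFun_oddDistinct_even (k : ℕ) :
    boundedGenFun OddDistinct (2 * k + 2) * (1 - X ^ (2 * k + 2)) =
      boundedGenFun OddDistinct (2 * k + 1) :=
  boundedGenFun_succ_of_free fun m h ↦ by grind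

theorem one_sub_X_pow_succ_ne_zero (k : ℕ) : (1 - X ^ (k + 1) : ℤ⟦X⟧) ≠ 0 := fun h ↦ by
  simpa using congrArg constantCoeff h

theorem sum_boundedGenFun_oddDistinct (M : ℕ) :
    (1 + X ^ 3) * ∑ k ∈ range (M + 1), X ^ (2 * k + 2) * boundedGenFun OddDistinct (2 * k + 1) =
      (X ^ 2 + X ^ (2 * M + 5)) * boundedGenFun OddDistinct (2 * M + 1) := by
  induction M with
  | zero => simp; ring
  | succ M ih =>
    rw [sum_range_succ, mul_add, ih]
    apply mul_right_cancel₀ (one_sub_X_pow_succ_ne_zero (2 * M + 1))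
    have h1 := boundedGenFun_oddDistinct_odd (M + 1)
    have h2 := boundedGenFun_oddDistinct_even M
    rw [show 2 * (M + 1) = 2 * M + 2 by ring] at *
    rw [h1, ← h2]
    ring

theorem boundedGenFun_oddDistinct_mul_prod (K : ℕ) :
    boundedGenFun OddDistinct (4 * K) * ∏ k ∈ range K, (1 - X ^ (4 * k + 2)) =
      boundedGenFun NotTwoModFour (4 * K) * ∏ k ∈ range (2 * K), (1 - X ^ (4 * k + 2)) := by
  induction K with
  | zero => simp [boundedGenFun_zero]
  | succ K ih =>
    have d1 := boundedGenFun_oddDistinct_odd (2 * K)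
    have d2 := boundedGenFun_oddDistinct_even (2 * K)
    have d3 := boundedGenFun_oddDistinct_odd (2 * K + 1)
    have d4 := boundedGenFun_oddDistinct_even (2 * K + 1)
    have c1 : boundedGenFun NotTwoModFour (4 * K + 1) * (1 - X ^ (4 * K + 1)) = _ :=
      boundedGenFun_succ_of_free fun m ↦ by grind [NotTwoModFour]
    have c2 : boundedGenFun NotTwoModFour (4 * K + 2) = _ :=
      boundedGenFun_succ_of_forbidden fun m ↦ by grind [NotTwoModFour]
    have c3 : boundedGenFun NotTwoModFour (4 * K + 3) * (1 - X ^ (4 * K + 3)) = _ :=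
      boundedGenFun_succ_of_free fun m ↦ by grind [NotTwoModFour]
    have c4 : boundedGenFun NotTwoModFour (4 * K + 4) * (1 - X ^ (4 * K + 4)) = _ :=
      boundedGenFun_succ_of_free fun m ↦ by grind [NotTwoModFour]
    rw [show 2 * (2 * K + 1) = 4 * K + 2 by ring] at d3 d4
    rw [show 2 * (2 * K) = 4 * K by ring] at d1 d2
    rw [show 4 * (K + 1) = 4 * K + 4 by ring, show 2 * (K + 1) = 2 * K + 1 + 1 by ring,
      prod_range_succ, prod_range_succ, prod_range_succ,
      show 4 * (2 * K) + 2 = 2 * (4 * K + 1) by ring,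
      show 4 * (2 * K + 1) + 2 = 2 * (4 * K + 3) by ring]
    apply mul_right_cancel₀ (one_sub_X_pow_succ_ne_zero (4 * K + 3))
    generalize (∏ k ∈ range K, (1 - X ^ (4 * k + 2)) : ℤ⟦X⟧) = A at *
    generalize (∏ k ∈ range (2 * K), (1 - X ^ (4 * k + 2)) : ℤ⟦X⟧) = B at *
    simp only [add_assoc, Nat.reduceAdd] at *
    calc _ = (boundedGenFun OddDistinct (4 * K + 4) * (1 - X ^ (4 * K + 4))) * A
            * (1 - X ^ (4 * K + 2)) := by ring
      _ = (boundedGenFun OddDistinct (4 * K + 2) * (1 - X ^ (4 * K + 2))) * A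
            * (1 + X ^ (4 * K + 3)) := by rw [d4, d3]; ring
      _ = (boundedGenFun OddDistinct (4 * K) * A) * (1 + X ^ (4 * K + 1))
            * (1 + X ^ (4 * K + 3)) := by rw [d2, d1]; ring
      _ = (boundedGenFun NotTwoModFour (4 * K + 1) * (1 - X ^ (4 * K + 1))) * B
            * (1 + X ^ (4 * K + 1)) * (1 + X ^ (4 * K + 3)) := by rw [ih, c1]
      _ = (boundedGenFun NotTwoModFour (4 * K + 3) * (1 - X ^ (4 * K + 3))) * B
            * (1 - X ^ (2 * (4 * K + 1))) * (1 + X ^ (4 * K + 3)) := by rw [c3, c2]; ring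
      _ = _ := by rw [← c4]; ring

theorem coeff_mul_prod_one_sub_X_pow {ι : Type*} {n : ℕ} (s : Finset ι) (e : ι → ℕ)
    (he : ∀ i ∈ s, n < e i) (f : ℤ⟦X⟧) :
    coeff n (f * ∏ i ∈ s, (1 - X ^ e i)) = coeff n f := by
  classical
  induction s using Finset.induction_on with
  | empty => simp
  | insert a s ha ih =>
    rw [prod_insert ha, mul_left_comm, sub_mul, one_mul, map_sub, coeff_X_pow_mul',
      if_neg (by simpa using he a (mem_insert_self a s)), sub_zero,
      ih fun i hi ↦ he i (mem_insert_of_mem hi)]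

theorem coeff_boundedGenFun_oddDistinct_eq_notTwoModFour {n K : ℕ} (h : n < 4 * K) :
    coeff n (boundedGenFun OddDistinct (4 * K)) = coeff n (boundedGenFun NotTwoModFour (4 * K)) := by
  have key : boundedGenFun OddDistinct (4 * K) =
      boundedGenFun NotTwoModFour (4 * K) * ∏ k ∈ range K, (1 - X ^ (4 * (K + k) + 2)) := by
    have hne : (∏ k ∈ range K, (1 - X ^ (4 * k + 2)) : ℤ⟦X⟧) ≠ 0 :=
      prod_ne_zero_iff.mpr fun k _ ↦ one_sub_X_pow_succ_ne_zero _
    apply mul_right_cancel₀ hne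
    rw [boundedGenFun_oddDistinct_mul_prod, two_mul, prod_range_add]
    ring
  rw [key, coeff_mul_prod_one_sub_X_pow _ _ (by intros; lia)]

theorem coeff_boundedGenFun_of_le {P : ℕ → ℕ → Prop} {n N N' : ℕ} (h : n ≤ N) (h' : n ≤ N') :
    coeff n (boundedGenFun P N) = coeff n (boundedGenFun P N') := by
  classical
  simp_rw [coeff_boundedGenFun]
  congr! 5 with p _ a ha
  have := Nat.Partition.le_of_mem_parts ha
  lia

theorem coeff_boundedGenFun_oddDistinct {n N : ℕ} (h : n ≤ N) :
    coeff n (boundedGenFun OddDistinct N) = c n := by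
  classical
  rw [coeff_boundedGenFun_of_le h (show n ≤ 4 * (n + 1) by lia),
    coeff_boundedGenFun_oddDistinct_eq_notTwoModFour (by lia), coeff_boundedGenFun, c,
    Nat.card_eq_fintype_card, Fintype.card_subtype]
  congr! 5 with p _ a ha
  have := Nat.Partition.le_of_mem_parts ha
  simp only [NotTwoModFour, and_iff_right_iff_imp]
  lia

/-- The partitions counted by `o3`. -/
def IsO3 (s : Multiset ℕ) : Prop :=
  (∀ a : ℕ, Odd a → s.count a ≤ 1) ∧ Even s.sup ∧ (s = 0 ∨ s.count s.sup = 1)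

theorem isO3_cons {s : Multiset ℕ} {k : ℕ}
    (h : ∀ a ∈ s, a ≤ 2 * k + 1 ∧ OddDistinct a (s.count a)) :
    IsO3 ((2 * k + 2) ::ₘ s) ∧ ((2 * k + 2) ::ₘ s).sup = 2 * k + 2 := by
  have hsup : ((2 * k + 2) ::ₘ s).sup = 2 * k + 2 := by
    rw [Multiset.sup_cons, sup_eq_left, Multiset.sup_le]
    exact fun a ha ↦ (h a ha).1.trans (by lia)
  have hnot : 2 * k + 2 ∉ s := fun hm ↦ by have := (h _ hm).1; lia
  refine ⟨⟨fun a ha ↦ ?_, ?_, Or.inr ?_⟩, hsup⟩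
  · rw [Multiset.count_cons_of_ne (by grind)]
    by_cases hm : a ∈ s
    · exact (h a hm).2 ha
    · simp [hm]
  · rw [hsup]; exact ⟨k + 1, by ring⟩
  · rw [hsup, Multiset.count_cons_self, Multiset.count_eq_zero_of_notMem hnot]

theorem exists_cons_of_isO3 {s : Multiset ℕ} {k : ℕ} (h : IsO3 s) (hk : s.sup = 2 * k + 2) :
    ∃ t, s = (2 * k + 2) ::ₘ t ∧ ∀ a ∈ t, a ≤ 2 * k + 1 ∧ OddDistinct a (t.count a) := by
  obtain ⟨h1, -, h3⟩ := h
  have hs : s ≠ 0 := by rintro rfl; simp at hk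
  have hc : s.count (2 * k + 2) = 1 := by rw [← hk]; exact h3.resolve_left hs
  obtain ⟨t, rfl⟩ := Multiset.exists_cons_of_mem (Multiset.one_le_count_iff_mem.mp hc.ge)
  have hnot : 2 * k + 2 ∉ t := by simpa using hc
  refine ⟨t, rfl, fun a ha ↦ ⟨?_, fun ho ↦ ?_⟩⟩
  · have hle : a ≤ 2 * k + 2 := hk ▸ Multiset.le_sup (Multiset.mem_cons_of_mem ha)
    have hne : a ≠ 2 * k + 2 := fun e ↦ hnot (e ▸ ha)
    lia
  · exact (Multiset.count_le_count_cons a _ t).trans (h1 a ho)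

open scoped Classical in
theorem card_isO3_sup_eq (r k : ℕ) :
    (#{p : (r + (2 * k + 2)).Partition | IsO3 p.parts ∧ p.parts.sup = 2 * k + 2} : ℤ) =
      coeff r (boundedGenFun OddDistinct (2 * k + 1)) := by
  rw [coeff_boundedGenFun]
  norm_cast
  symm
  refine card_bij (fun q _ ↦ ⟨(2 * k + 2) ::ₘ q.parts, ?_, ?_⟩) ?_ ?_ ?_
  · intro i hi
    rcases Multiset.mem_cons.mp hi with rfl | hi
    · lia
    · exact q.parts_pos hi
  · rw [Multiset.sum_cons, q.parts_sum, add_comm]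
  · intro q hq
    simpa using isO3_cons (by simpa using hq)
  · intro q _ q' _ e
    simpa [Nat.Partition.ext_iff] using e
  · intro p hp
    obtain ⟨h1, h2⟩ := (mem_filter.mp hp).2
    obtain ⟨t, ht, hb⟩ := exists_cons_of_isO3 h1 h2
    refine ⟨⟨t, fun hi ↦ p.parts_pos (ht ▸ Multiset.mem_cons_of_mem hi), ?_⟩, by simpa using hb,
      Nat.Partition.ext ht.symm⟩
    have := p.parts_sum
    rw [ht, Multiset.sum_cons] at this
    lia

theorem coeff_sum_boundedGenFun_oddDistinct {n M : ℕ} (hn : n ≠ 0) (hM : n ≤ M) :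
    coeff n (∑ k ∈ range (M + 1), (X : ℤ⟦X⟧) ^ (2 * k + 2) * boundedGenFun OddDistinct (2 * k + 1)) =
      o3 n := by
  classical
  have hle (p : n.Partition) : p.parts.sup ≤ n :=
    Multiset.sup_le.mpr fun _ ↦ Nat.Partition.le_of_mem_parts
  have hcard : o3 n = #{p : n.Partition | IsO3 p.parts} := by
    change Nat.card {p : n.Partition // IsO3 p.parts} = _
    rw [Nat.card_eq_fintype_card, Fintype.card_subtype]
  rw [hcard, card_eq_sum_card_fiberwise (f := fun p ↦ p.parts.sup / 2 - 1) (t := range (M + 1)),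
    map_sum, Nat.cast_sum]
  · refine sum_congr rfl fun k _ ↦ ?_
    have hfib (p : n.Partition) : (IsO3 p.parts ∧ p.parts.sup / 2 - 1 = k) ↔
        (IsO3 p.parts ∧ p.parts.sup = 2 * k + 2) := by
      refine and_congr_right fun h ↦ ⟨fun e ↦ ?_, fun e ↦ by lia⟩
      have hpos : p.parts.sup ≠ 0 := fun h0 ↦ by
        have hp : p.parts = 0 := Multiset.eq_zero_of_forall_notMem fun a ha ↦ by
          have := Multiset.le_sup ha
          have := p.parts_pos ha
          lia
        exact hn (by simpa [hp] using p.parts_sum.symm)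
      obtain ⟨m, hm⟩ := h.2.1
      lia
    rw [filter_filter]
    simp_rw [hfib]
    rw [coeff_X_pow_mul']
    split_ifs with h
    · obtain ⟨r, rfl⟩ := Nat.exists_eq_add_of_le' h
      rw [card_isO3_sup_eq, Nat.add_sub_cancel]
    · symm
      norm_cast
      rw [card_eq_zero, filter_eq_empty_iff]
      intro p _ hp
      have := hle p
      lia
  · intro p _
    have := hle p
    simp only [coe_range, Set.mem_Iio]
    lia

theorem o3_add_o3_eq_c (n : ℕ) (hn : 2 < n) :
    o3 (n + 2) + o3 (n - 1) = c n := by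
  have h := congrArg (coeff (n + 2)) (sum_boundedGenFun_oddDistinct (n + 2))
  rw [add_mul, add_mul, one_mul, map_add, map_add, coeff_X_pow_mul', coeff_X_pow_mul',
    coeff_X_pow_mul', if_pos (by lia), if_pos (by lia), if_neg (by lia),
    show n + 2 - 3 = n - 1 by lia, Nat.add_sub_cancel, add_zero,
    coeff_sum_boundedGenFun_oddDistinct (by lia) le_rfl,
    coeff_sum_boundedGenFun_oddDistinct (by lia) (by lia),
    coeff_boundedGenFun_oddDistinct (by lia)] at h
  exact_mod_cast h
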